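/- Let I ⊆ A and J ⊆ B be monomial ideals, s ≥ 1, and γ = (α,β) ∈ ℤ^σ × ℤ^τ. Then Δ_γ((I+J)^{(s)}) = ⋃_{j=1}^{s} Δ_α(I^{(j)}) ∗ Δ_β(J^{(s−j+1)}); that is, for every subset F of (σ ⊔ τ)∖G_γ, F ∈ Δ_γ((I+J)^{(s)}) if and only if there exists j with 1 ≤ j ≤ s such that F ∩ σ ∈ Δ_α(I^{(j)}) and F ∩ τ ∈ Δ_β(J^{(s−j+1)}). -/

import Mathlib

open MvPolynomial

noncomputable section

variable (k : Type*) [Field k]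

/-- The multiplicative submonoid of `S = k[x_i : i ∈ σ]` generated by the variables `x_i, i ∈ F`. -/
def varSubmonoid (σ : Type*) (F : Set σ) : Submonoid (MvPolynomial σ k) :=
  Submonoid.closure ((fun i => (X i : MvPolynomial σ k)) '' F)

/-- The localization `S_F` of `S` at the variables indexed by `F`. -/
abbrev Loc (σ : Type*) (F : Set σ) : Type _ := Localization (varSubmonoid k σ F)

/-- The ideal `I S_F` of `S_F` generated by the image of `I`. -/
def locIdeal {σ : Type*} (I : Ideal (MvPolynomial σ k)) (F : Set σ) : Ideal (Loc k σ F) :=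
  Ideal.map (algebraMap (MvPolynomial σ k) (Loc k σ F)) I

/-- `G_γ = {i | γ i < 0}`. -/
def negSupp {σ : Type*} (γ : σ → ℤ) : Set σ := {i | γ i < 0}

/-- The element `x^γ` of `S_F` (meaningful when `G_γ ⊆ F`):  the image of the monomial with
exponents `max (γ i) 0` multiplied by the inverse of the image of `∏ x_i ^ (-γ i)` over `G_γ`. -/
def xpow {σ : Type*} [Fintype σ] (F : Set σ) (γ : σ → ℤ) : Loc k σ F :=
  algebraMap (MvPolynomial σ k) (Loc k σ F) (∏ i, X i ^ (γ i).toNat) *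
    Ring.inverse (algebraMap (MvPolynomial σ k) (Loc k σ F) (∏ i, X i ^ (-γ i).toNat))

/-- The degree complex `Δ_γ(I)`: all `F ⊆ σ \ G_γ` with `x^γ ∉ I S_{F ∪ G_γ}`. -/
def degCx {σ : Type*} [Fintype σ] (I : Ideal (MvPolynomial σ k)) (γ : σ → ℤ) : Set (Set σ) :=
  {F | F ⊆ (negSupp γ)ᶜ ∧ xpow k (F ∪ negSupp γ) γ ∉ locIdeal k I (F ∪ negSupp γ)}

/-- A monomial ideal is an ideal generated by monomials. -/
def IsMonomialIdeal {σ : Type*} (I : Ideal (MvPolynomial σ k)) : Prop :=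
  ∃ G : Set (σ →₀ ℕ),
    I = Ideal.span ((fun d => (monomial d (1 : k) : MvPolynomial σ k)) '' G)

/-- Extension of an ideal of `A = k[x_i : i ∈ σ]` to `S = k[x_i : i ∈ σ ⊕ τ]` along the
renaming of variables by `Sum.inl`. -/
def extL {σ τ : Type*} (I : Ideal (MvPolynomial σ k)) : Ideal (MvPolynomial (σ ⊕ τ) k) :=
  Ideal.map (rename (Sum.inl : σ → σ ⊕ τ) :
    MvPolynomial σ k →ₐ[k] MvPolynomial (σ ⊕ τ) k).toRingHom I

/-- Extension of an ideal of `B = k[x_i : i ∈ τ]` to `S = k[x_i : i ∈ σ ⊕ τ]` along the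
renaming of variables by `Sum.inr`. -/
def extR {σ τ : Type*} (J : Ideal (MvPolynomial τ k)) : Ideal (MvPolynomial (σ ⊕ τ) k) :=
  Ideal.map (rename (Sum.inr : τ → σ ⊕ τ) :
    MvPolynomial τ k →ₐ[k] MvPolynomial (σ ⊕ τ) k).toRingHom J

/-- The maximal homogeneous ideal, generated by all the variables. -/
def maxIdeal (σ : Type*) : Ideal (MvPolynomial σ k) :=
  Ideal.span (Set.range (X : σ → MvPolynomial σ k))

/-- The `s`-th symbolic power of an ideal `K` of `R`: the intersection over the associated
primes `p` of `R ⧸ K` of the preimages in `R` of `p^s R_p` under `R → R_p`. -/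
def symbPow {R : Type*} [CommRing R] (K : Ideal R) (s : ℕ) : Ideal R :=
  ⨅ p : {p : Ideal R // p ∈ associatedPrimes R (R ⧸ K)},
    letI : p.1.IsPrime := (p.2 : IsAssociatedPrime p.1 (R ⧸ K)).1
    Ideal.comap (algebraMap R (Localization.AtPrime p.1))
      (Ideal.map (algebraMap R (Localization.AtPrime p.1)) (p.1 ^ s))

/-- The prime ideal generated by the variables indexed by `T`. -/
def varIdeal {σ : Type*} (T : Finset σ) : Ideal (MvPolynomial σ k) :=
  Ideal.span (X '' (T : Set σ))

/-- `T` indexes an associated prime of a monomial ideal `K` witnessed by a monomial: there is a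
monomial `x^a` with `K : x^a` having the same monomials as the ideal of the variables in `T`. -/
def IsMonomialWitnessed {σ : Type*} (K : Ideal (MvPolynomial σ k)) (T : Finset σ) : Prop :=
  ∃ a : σ →₀ ℕ, ∀ m : σ →₀ ℕ, monomial (m + a) (1 : k) ∈ K ↔ ∃ i ∈ T, m i ≠ 0

section

variable {k} {σ : Type*}

theorem mem_varIdeal_iff {T : Finset σ} {f : MvPolynomial σ k} :
    f ∈ varIdeal k T ↔ ∀ m ∈ f.support, ∃ i ∈ T, m i ≠ 0 := by
  simp [varIdeal, mem_ideal_span_X_image]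

theorem monomial_mem_varIdeal_iff {T : Finset σ} {m : σ →₀ ℕ} :
    monomial m (1 : k) ∈ varIdeal k T ↔ ∃ i ∈ T, m i ≠ 0 := by
  classical
  simp [mem_varIdeal_iff, support_monomial]

theorem varIdeal_isPrime (T : Finset σ) : (varIdeal k T).IsPrime := by
  classical
  let φ : MvPolynomial σ k →ₐ[k] MvPolynomial σ k := aeval fun i => if i ∈ T then 0 else X i
  have hφ : ∀ f, Ideal.Quotient.mkₐ k (varIdeal k T) (φ f) =
      Ideal.Quotient.mkₐ k (varIdeal k T) f := by
    refine DFunLike.congr_fun (f := (Ideal.Quotient.mkₐ k (varIdeal k T)).comp φ)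
      (MvPolynomial.algHom_ext fun i => ?_)
    by_cases hi : i ∈ T
    · simp only [φ, AlgHom.comp_apply, aeval_X, hi, if_true, map_zero]
      exact (Ideal.Quotient.eq_zero_iff_mem.2 (Ideal.subset_span (Set.mem_image_of_mem X hi))).symm
    · simp [φ, hi]
  have hker : varIdeal k T = RingHom.ker φ := by
    refine le_antisymm (Ideal.span_le.2 ?_) fun f hf => ?_
    · rintro _ ⟨i, hi, rfl⟩
      have hi' : i ∈ T := hi
      simp [φ, hi']
    · have h := hφ f
      rw [RingHom.mem_ker] at hf
      rw [hf, map_zero] at h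
      exact Ideal.Quotient.eq_zero_iff_mem.1 h.symm
  rw [hker]
  exact RingHom.ker_isPrime _

theorem mem_of_forall_monomial_mem {K : Ideal (MvPolynomial σ k)} {f : MvPolynomial σ k}
    (h : ∀ m ∈ f.support, monomial m (1 : k) ∈ K) : f ∈ K := by
  rw [f.as_sum]
  refine Ideal.sum_mem _ fun m hm => ?_
  rw [← mul_one (coeff m f), ← C_mul_monomial]
  exact K.mul_mem_left _ (h m hm)

theorem IsMonomialIdeal.mem_iff {K : Ideal (MvPolynomial σ k)} (hK : IsMonomialIdeal k K)
    {f : MvPolynomial σ k} : f ∈ K ↔ ∀ m ∈ f.support, monomial m (1 : k) ∈ K := by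
  classical
  obtain ⟨G, rfl⟩ := hK
  simp [mem_ideal_span_monomial_image, support_monomial]

theorem support_sub_monomial_subset [DecidableEq σ] {f : MvPolynomial σ k} {a : σ →₀ ℕ} :
    (f - monomial a (f.coeff a)).support ⊆ f.support.erase a := by
  intro d hd
  rw [mem_support_iff, coeff_sub, coeff_monomial] at hd
  rw [Finset.mem_erase, mem_support_iff]
  by_cases h : a = d
  · subst h; simp at hd
  · rw [if_neg h, sub_zero] at hd
    exact ⟨fun h' => h h'.symm, hd⟩

theorem card_support_sub_monomial_lt {f : MvPolynomial σ k} {a : σ →₀ ℕ} (ha : a ∈ f.support) :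
    (f - monomial a (f.coeff a)).support.card < f.support.card := by
  classical
  exact (Finset.card_le_card support_sub_monomial_subset).trans_lt (Finset.card_erase_lt_of_mem ha)

theorem card_support_monomial_mul_le (f : MvPolynomial σ k) (a : σ →₀ ℕ) :
    (monomial a (1 : k) * f).support.card ≤ f.support.card := by
  classical
  refine (Finset.card_le_card (support_mul _ _)).trans ?_
  refine (Finset.card_add_le).trans ?_
  rw [support_monomial, if_neg one_ne_zero]
  simp

/-- A prime of the form `K : f`, with `K` a monomial ideal, contains the terms of its elements. -/
theorem IsMonomialIdeal.monomial_mem_of_prime_colon [Finite σ] {K p : Ideal (MvPolynomial σ k)}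
    (hK : IsMonomialIdeal k K) (hp : p.IsPrime)
    (hf : ∃ f : MvPolynomial σ k, ∀ g, g ∈ p ↔ g * f ∈ K)
    {g : MvPolynomial σ k} (hg : g ∈ p) {d : σ →₀ ℕ} (hd : d ∈ g.support) :
    monomial d (1 : k) ∈ p := by
  classical
  obtain ⟨f, hf, hmin⟩ : ∃ f : MvPolynomial σ k, (∀ g, g ∈ p ↔ g * f ∈ K) ∧
      ∀ f' : MvPolynomial σ k, (∀ g, g ∈ p ↔ g * f' ∈ K) → f.support.card ≤ f'.support.card := by
    obtain ⟨f, h, h'⟩ := WellFounded.has_min (measure fun f : MvPolynomial σ k => f.support.card).wf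
      {f | ∀ g, g ∈ p ↔ g * f ∈ K} hf
    exact ⟨f, h, fun f' hf' => not_lt.1 (h' f' hf')⟩
  have hf0 : f ≠ 0 := by
    rintro rfl
    exact hp.ne_top ((Ideal.eq_top_iff_one _).2 ((hf 1).2 (by simp)))
  obtain ⟨n, ⟨e⟩⟩ := Finite.exists_equiv_fin σ
  let : LinearOrder σ := LinearOrder.lift' e e.injective
  let o : MonomialOrder σ := MonomialOrder.lex
  induction hn : g.support.card using Nat.strong_induction_on generalizing g with
  | _ n ih =>
  have hg0 : g ≠ 0 := by rintro rfl; simp at hd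
  have hlead : monomial (o.degree g) (1 : k) ∈ p := by
    by_contra hnot
    have hmem : monomial (o.degree g + o.degree f) (1 : k) ∈ K := by
      refine hK.mem_iff.1 ((hf g).1 hg) _ ?_
      rw [mem_support_iff, MonomialOrder.coeff_mul_of_degree_add]
      exact mul_ne_zero (by simpa using hg0) (by simpa using hf0)
    refine (hmin (monomial (o.degree g) 1 * (f - monomial (o.degree f) (f.coeff (o.degree f))))
      fun h => ?_).not_gt ((card_support_monomial_mul_le _ _).trans_lt
        (card_support_sub_monomial_lt (o.degree_mem_support hf0)))
    have h1 : h * (monomial (o.degree g) 1 * monomial (o.degree f) (f.coeff (o.degree f))) ∈ K := by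
      rw [monomial_mul, one_mul, ← mul_one (f.coeff _), ← C_mul_monomial]
      exact K.mul_mem_left _ (K.mul_mem_left _ hmem)
    rw [mul_sub, mul_sub, Submodule.sub_mem_iff_left _ h1, ← mul_assoc, ← hf,
      hp.mul_mem_iff_mem_or_mem]
    simp [hnot]
  by_cases hdg : d = o.degree g
  · rwa [hdg]
  · refine ih _ ?_ (g := g - monomial (o.degree g) (g.coeff (o.degree g))) ?_ ?_ rfl
    · rw [← hn]; exact card_support_sub_monomial_lt (o.degree_mem_support hg0)
    · refine sub_mem hg ?_
      rw [← mul_one (g.coeff _), ← C_mul_monomial]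
      exact p.mul_mem_left _ hlead
    · rw [mem_support_iff] at hd ⊢
      rwa [coeff_sub, coeff_monomial, if_neg (Ne.symm hdg), sub_zero]

theorem exists_var_mem_of_monomial_mem {p : Ideal (MvPolynomial σ k)} (hp : p.IsPrime)
    {m : σ →₀ ℕ} (hm : monomial m (1 : k) ∈ p) : ∃ i, m i ≠ 0 ∧ X i ∈ p := by
  rw [← prod_X_pow_eq_monomial, hp.prod_mem_iff] at hm
  obtain ⟨i, hi, h⟩ := hm
  exact ⟨i, by simpa using hi, hp.mem_of_pow_mem _ h⟩

theorem monomial_mem_of_X_mem {p : Ideal (MvPolynomial σ k)} {m : σ →₀ ℕ} {i : σ} (hi : m i ≠ 0)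
    (h : (X i : MvPolynomial σ k) ∈ p) : monomial m (1 : k) ∈ p :=
  p.mem_of_dvd (by rw [X, monomial_dvd_monomial]; simpa [Nat.one_le_iff_ne_zero] using hi) h

theorem mem_associatedPrimes_iff_mul_mem {R : Type*} [CommRing R] [IsNoetherianRing R]
    {K p : Ideal R} :
    p ∈ associatedPrimes R (R ⧸ K) ↔ p.IsPrime ∧ ∃ f, ∀ g, g ∈ p ↔ g * f ∈ K := by
  rw [AssociatedPrimes.mem_iff, isAssociatedPrime_iff]
  refine and_congr_right fun _ => ?_
  rw [Ideal.Quotient.mk_surjective.exists]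
  refine exists_congr fun f => ?_
  rw [SetLike.ext_iff]
  refine forall_congr' fun g => ?_
  rw [Submodule.mem_colon_singleton, Submodule.mem_bot, Algebra.smul_def,
    Ideal.Quotient.algebraMap_eq, ← map_mul, Ideal.Quotient.eq_zero_iff_mem]

/-- The associated primes of a monomial ideal are generated by variables and are annihilators of
monomials. -/
theorem IsMonomialIdeal.mem_associatedPrimes_iff [Finite σ] {K p : Ideal (MvPolynomial σ k)}
    (hK : IsMonomialIdeal k K) :
    p ∈ associatedPrimes (MvPolynomial σ k) (MvPolynomial σ k ⧸ K) ↔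
      ∃ T : Finset σ, IsMonomialWitnessed k K T ∧ p = varIdeal k T := by
  classical
  rw [mem_associatedPrimes_iff_mul_mem]
  constructor
  · rintro ⟨hp, f, hf⟩
    have := Fintype.ofFinite σ
    have hmon : ∀ m : σ →₀ ℕ, monomial m (1 : k) ∈ p ↔
        ∃ i ∈ Finset.univ.filter fun i => (X i : MvPolynomial σ k) ∈ p, m i ≠ 0 := by
      refine fun m => ⟨fun hm => ?_, ?_⟩
      · obtain ⟨i, hi, h⟩ := exists_var_mem_of_monomial_mem hp hm
        exact ⟨i, by simpa using h, hi⟩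
      · rintro ⟨i, h, hi⟩
        exact monomial_mem_of_X_mem hi (by simpa using h)
    have hpmem : ∀ g, g ∈ p ↔ ∀ m ∈ g.support, monomial m (1 : k) ∈ p := fun g =>
      ⟨fun hg m hm => hK.monomial_mem_of_prime_colon hp ⟨f, hf⟩ hg hm,
        mem_of_forall_monomial_mem⟩
    refine ⟨Finset.univ.filter fun i => (X i : MvPolynomial σ k) ∈ p, ?_, ?_⟩
    · obtain ⟨a, ha, hle⟩ := (hp.inf_le' (s := f.support)
        (f := fun a => K.colon {monomial a (1 : k)})).1 fun g hg => by
          rw [Submodule.mem_finsetInf] at hg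
          rw [hf, f.as_sum, Finset.mul_sum]
          refine Ideal.sum_mem _ fun a ha => ?_
          have := hg a ha
          rw [Submodule.mem_colon_singleton, smul_eq_mul] at this
          rw [← mul_one (coeff a f), ← C_mul_monomial, mul_left_comm]
          exact K.mul_mem_left _ this
      refine ⟨a, fun m => ?_⟩
      rw [← hmon]
      constructor
      · intro h
        apply hle
        rw [Submodule.mem_colon_singleton, smul_eq_mul, monomial_mul, one_mul]
        exact h
      · intro h
        refine hK.mem_iff.1 ((hf _).1 h) _ ?_
        rwa [mem_support_iff, coeff_monomial_mul, one_mul, ← mem_support_iff]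
    · ext g
      rw [hpmem, mem_varIdeal_iff]
      exact forall₂_congr fun m _ => hmon m
  · rintro ⟨T, ⟨a, ha⟩, rfl⟩
    refine ⟨varIdeal_isPrime T, monomial a 1, fun g => ?_⟩
    have hsupp : (g * monomial a (1 : k)).support = g.support.map (addRightEmbedding a) := by
      ext d
      simp only [mem_support_iff, Finset.mem_map, addRightEmbedding_apply, coeff_mul_monomial']
      constructor
      · intro h
        split_ifs at h with had
        · exact ⟨d - a, by simpa using h, tsub_add_cancel_of_le had⟩
        · exact absurd rfl h
      · rintro ⟨e, he, rfl⟩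
        simpa using he
    rw [hK.mem_iff, mem_varIdeal_iff, hsupp]
    simp [ha]

theorem sum_le_of_mem_varIdeal_pow {T : Finset σ} {s : ℕ} {f : MvPolynomial σ k}
    (hf : f ∈ varIdeal k T ^ s) {m : σ →₀ ℕ} (hm : m ∈ f.support) : s ≤ ∑ i ∈ T, m i := by
  classical
  induction s generalizing f m with
  | zero => exact Nat.zero_le _
  | succ s ih =>
    rw [pow_succ] at hf
    induction hf using Submodule.mul_induction_on' generalizing m with
    | mem_mul_mem g hg h hh =>
      obtain ⟨a, ha, b, hb, rfl⟩ := Finset.mem_add.1 (support_mul _ _ hm)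
      obtain ⟨i, hi, hbi⟩ := mem_varIdeal_iff.1 hh b hb
      have h1 : b i ≤ ∑ i ∈ T, b i := Finset.single_le_sum (fun _ _ => Nat.zero_le _) hi
      have h2 := ih hg ha
      simp only [Finsupp.add_apply, Finset.sum_add_distrib]
      lia
    | add g _ h _ hg hh =>
      rcases Finset.mem_union.1 (support_add hm) with hm | hm
      exacts [hg hm, hh hm]

theorem monomial_mem_varIdeal_pow [Finite σ] {T : Finset σ} {s : ℕ} {m : σ →₀ ℕ}
    (hm : s ≤ ∑ i ∈ T, m i) : monomial m (1 : k) ∈ varIdeal k T ^ s := by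
  classical
  have := Fintype.ofFinite σ
  refine Ideal.pow_le_pow_right hm ?_
  have h : monomial m (1 : k) = (∏ i ∈ T, X i ^ m i) * ∏ i ∈ Tᶜ, X i ^ m i := by
    rw [Finset.prod_mul_prod_compl, monomial_eq, C_1, one_mul, Finsupp.prod_fintype _ _ (by simp)]
  rw [h, ← Finset.prod_pow_eq_pow_sum]
  refine Ideal.mul_mem_right _ _ (Ideal.prod_mem_prod fun i hi => Ideal.pow_mem_pow ?_ _)
  exact Ideal.subset_span (Set.mem_image_of_mem X hi)

theorem monomial_mem_symbolicPower_varIdeal_iff [Finite σ] {T : Finset σ}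
    [(varIdeal k T).IsPrime] {s : ℕ} {m : σ →₀ ℕ} :
    algebraMap _ (Localization.AtPrime (varIdeal k T)) (monomial m (1 : k)) ∈
      Ideal.map (algebraMap _ (Localization.AtPrime (varIdeal k T))) (varIdeal k T ^ s) ↔
      s ≤ ∑ i ∈ T, m i := by
  rw [IsLocalization.algebraMap_mem_map_algebraMap_iff (varIdeal k T).primeCompl]
  constructor
  · rintro ⟨u, hu, h⟩
    rw [Ideal.mem_primeCompl_iff, mem_varIdeal_iff] at hu
    push Not at hu
    obtain ⟨b, hb, hbT⟩ := hu
    have hle := sum_le_of_mem_varIdeal_pow h (m := b + m) (by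
      rw [mem_support_iff, coeff_mul_monomial, mul_one]; exact mem_support_iff.1 hb)
    simpa [Finset.sum_add_distrib, Finset.sum_eq_zero hbT] using hle
  · exact fun h => ⟨1, one_mem _, by rw [one_mul]; exact monomial_mem_varIdeal_pow h⟩

theorem IsMonomialIdeal.monomial_mem_symbPow_iff [Finite σ] {K : Ideal (MvPolynomial σ k)}
    (hK : IsMonomialIdeal k K) {s : ℕ} {m : σ →₀ ℕ} :
    monomial m (1 : k) ∈ symbPow K s ↔
      ∀ T : Finset σ, IsMonomialWitnessed k K T → s ≤ ∑ i ∈ T, m i := by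
  simp only [symbPow, Ideal.mem_iInf, Ideal.mem_comap]
  constructor
  · intro h T hT
    have := varIdeal_isPrime (k := k) T
    exact monomial_mem_symbolicPower_varIdeal_iff.1
      (h ⟨varIdeal k T, hK.mem_associatedPrimes_iff.2 ⟨T, hT, rfl⟩⟩)
  · rintro h ⟨p, hp⟩
    obtain ⟨T, hT, rfl⟩ := hK.mem_associatedPrimes_iff.1 hp
    have := varIdeal_isPrime (k := k) T
    exact monomial_mem_symbolicPower_varIdeal_iff.2 (h T hT)

theorem mem_varSubmonoid_iff {F : Set σ} {f : MvPolynomial σ k} :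
    f ∈ varSubmonoid k σ F ↔ ∃ m : σ →₀ ℕ, (∀ i ∉ F, m i = 0) ∧ f = monomial m 1 := by
  classical
  constructor
  · intro hf
    induction hf using Submonoid.closure_induction with
    | mem f hf =>
      obtain ⟨i, hi, rfl⟩ := hf
      exact ⟨Finsupp.single i 1, fun j hj => Finsupp.single_eq_of_ne (by rintro rfl; exact hj hi),
        rfl⟩
    | one => exact ⟨0, by simp, rfl⟩
    | mul f g _ _ hf hg =>
      obtain ⟨a, ha, rfl⟩ := hf
      obtain ⟨b, hb, rfl⟩ := hg
      exact ⟨a + b, fun i hi => by simp [ha i hi, hb i hi], by simp [monomial_mul]⟩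
  · rintro ⟨m, hm, rfl⟩
    rw [← prod_X_pow_eq_monomial]
    refine Submonoid.prod_mem _ fun i hi => Submonoid.pow_mem _ (Submonoid.subset_closure
      (Set.mem_image_of_mem _ ?_)) _
    by_contra hiF
    exact (by simpa using hi : m i ≠ 0) (hm i hiF)

theorem prod_X_pow_eq_monomial_equivFunOnFinite [Fintype σ] (e : σ → ℕ) :
    ∏ i, (X i : MvPolynomial σ k) ^ e i = monomial (Finsupp.equivFunOnFinite.symm e) 1 := by
  rw [monomial_eq, C_1, one_mul, Finsupp.prod_fintype _ _ (by simp)]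
  simp

theorem xpow_mem_locIdeal_iff [Fintype σ] {K : Ideal (MvPolynomial σ k)} {F : Set σ} {γ : σ → ℤ}
    (hF : negSupp γ ⊆ F) :
    xpow k F γ ∈ locIdeal k K F ↔ ∃ b : σ →₀ ℕ, (∀ i ∉ F, b i = 0) ∧
      monomial (b + Finsupp.equivFunOnFinite.symm fun i => (γ i).toNat) (1 : k) ∈ K := by
  have hmem : ∏ i, X i ^ (-γ i).toNat ∈ varSubmonoid k σ F := by
    rw [prod_X_pow_eq_monomial_equivFunOnFinite]
    refine mem_varSubmonoid_iff.2 ⟨_, fun i hi => ?_, rfl⟩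
    have : ¬ γ i < 0 := fun h => hi (hF h)
    simp only [Finsupp.equivFunOnFinite_symm_apply_apply]
    lia
  have hunit := (IsLocalization.map_units (Loc k σ F)
    (⟨_, hmem⟩ : varSubmonoid k σ F)).ringInverse
  rw [xpow, locIdeal, Ideal.mul_unit_mem_iff_mem _ hunit,
    IsLocalization.algebraMap_mem_map_algebraMap_iff (varSubmonoid k σ F),
    prod_X_pow_eq_monomial_equivFunOnFinite]
  constructor
  · rintro ⟨u, hu, h⟩
    obtain ⟨b, hb, rfl⟩ := mem_varSubmonoid_iff.1 hu
    exact ⟨b, hb, by simpa [monomial_mul] using h⟩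
  · rintro ⟨b, hb, h⟩
    exact ⟨_, mem_varSubmonoid_iff.2 ⟨b, hb, rfl⟩, by simpa [monomial_mul] using h⟩

/-- The faces of the degree complexes of symbolic powers of a monomial ideal, in terms of its
associated primes. -/
theorem IsMonomialIdeal.mem_degCx_symbPow_iff [Fintype σ] {K : Ideal (MvPolynomial σ k)}
    (hK : IsMonomialIdeal k K) {s : ℕ} {γ : σ → ℤ} {F : Set σ} :
    F ∈ degCx k (symbPow K s) γ ↔ F ⊆ (negSupp γ)ᶜ ∧
      ∃ T : Finset σ, IsMonomialWitnessed k K T ∧ (∀ i ∈ T, i ∉ F ∪ negSupp γ) ∧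
        ∑ i ∈ T, (γ i).toNat < s := by
  classical
  refine and_congr_right fun _ => ?_
  rw [xpow_mem_locIdeal_iff Set.subset_union_right, ← not_iff_not, not_not]
  simp only [hK.monomial_mem_symbPow_iff, Finsupp.add_apply, Finset.sum_add_distrib,
    Finsupp.equivFunOnFinite_symm_apply_apply]
  push Not
  constructor
  · rintro ⟨b, hb, h⟩ T hT hTF
    simpa [Finset.sum_eq_zero fun i hi => hb i (hTF i hi)] using h T hT
  · intro h
    refine ⟨Finsupp.equivFunOnFinite.symm fun i => if i ∈ F ∪ negSupp γ then s else 0,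
      fun i hi => by simp only [Finsupp.equivFunOnFinite_symm_apply_apply, if_neg hi],
      fun T hT => ?_⟩
    by_cases hTF : ∀ i ∈ T, i ∉ F ∪ negSupp γ
    · exact le_add_left (h T hT hTF)
    · push Not at hTF
      obtain ⟨i, hi, hiF⟩ := hTF
      refine le_add_right (le_trans ?_ (Finset.single_le_sum (fun _ _ => Nat.zero_le _) hi))
      simp only [Finsupp.equivFunOnFinite_symm_apply_apply]
      rw [if_pos hiF]

variable {τ : Type*}

theorem extL_add_extR_eq_span {I : Ideal (MvPolynomial σ k)} {J : Ideal (MvPolynomial τ k)}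
    {G : Set (σ →₀ ℕ)} {H : Set (τ →₀ ℕ)}
    (hI : I = Ideal.span ((fun d => monomial d (1 : k)) '' G))
    (hJ : J = Ideal.span ((fun d => monomial d (1 : k)) '' H)) :
    extL k I + extR k J = Ideal.span ((fun d => monomial d (1 : k)) ''
      (Finsupp.mapDomain Sum.inl '' G ∪ Finsupp.mapDomain Sum.inr '' H)) := by
  subst hI hJ
  rw [Set.image_union, Ideal.span_union, Submodule.add_eq_sup]
  simp only [extL, extR, Ideal.map_span, Set.image_image]
  simp [rename_monomial]

theorem IsMonomialIdeal.extL_add_extR {I : Ideal (MvPolynomial σ k)}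
    {J : Ideal (MvPolynomial τ k)} (hI : IsMonomialIdeal k I) (hJ : IsMonomialIdeal k J) :
    IsMonomialIdeal k (extL k I + extR k J) := by
  obtain ⟨G, hG⟩ := hI
  obtain ⟨H, hH⟩ := hJ
  exact ⟨_, extL_add_extR_eq_span hG hH⟩

theorem IsMonomialIdeal.monomial_mem_extL_add_extR_iff {I : Ideal (MvPolynomial σ k)}
    {J : Ideal (MvPolynomial τ k)} (hI : IsMonomialIdeal k I) (hJ : IsMonomialIdeal k J)
    {a : σ →₀ ℕ} {b : τ →₀ ℕ} :
    monomial (Finsupp.sumElim a b) (1 : k) ∈ extL k I + extR k J ↔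
      monomial a (1 : k) ∈ I ∨ monomial b (1 : k) ∈ J := by
  classical
  obtain ⟨G, hG⟩ := hI
  obtain ⟨H, hH⟩ := hJ
  have hl : ∀ g : σ →₀ ℕ, g.mapDomain Sum.inl ≤ a.sumElim b ↔ g ≤ a := by
    refine fun g => ⟨fun h i => ?_, fun h i => ?_⟩
    · simpa [Finsupp.mapDomain_apply Sum.inl_injective] using h (Sum.inl i)
    · rcases i with i | i
      · simpa [Finsupp.mapDomain_apply Sum.inl_injective] using h i
      · rw [Finsupp.mapDomain_of_notMem_range _ _ (by simp)]
        exact Nat.zero_le _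
  have hr : ∀ g : τ →₀ ℕ, g.mapDomain Sum.inr ≤ a.sumElim b ↔ g ≤ b := by
    refine fun g => ⟨fun h i => ?_, fun h i => ?_⟩
    · simpa [Finsupp.mapDomain_apply Sum.inr_injective] using h (Sum.inr i)
    · rcases i with i | i
      · rw [Finsupp.mapDomain_of_notMem_range _ _ (by simp)]
        exact Nat.zero_le _
      · simpa [Finsupp.mapDomain_apply Sum.inr_injective] using h i
  rw [extL_add_extR_eq_span hG hH, hG, hH]
  simp [mem_ideal_span_monomial_image, support_monomial, or_and_right, exists_or, hl, hr]

/-- The associated primes of `I + J` are the sums of associated primes of `I` and `J`. -/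
theorem IsMonomialIdeal.isMonomialWitnessed_extL_add_extR_iff {I : Ideal (MvPolynomial σ k)}
    {J : Ideal (MvPolynomial τ k)} (hI : IsMonomialIdeal k I) (hJ : IsMonomialIdeal k J)
    {T : Finset σ} {U : Finset τ} :
    IsMonomialWitnessed k (extL k I + extR k J) (T.disjSum U) ↔
      IsMonomialWitnessed k I T ∧ IsMonomialWitnessed k J U := by
  have hadd : ∀ (a c : σ →₀ ℕ) (b d : τ →₀ ℕ),
      a.sumElim b + c.sumElim d = (a + c).sumElim (b + d) := by
    intro a c b d
    ext (i | i) <;> simp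
  have hsplit : ∀ {P : (σ ⊕ τ →₀ ℕ) → Prop}, (∀ m, P m) ↔ ∀ a b, P (Finsupp.sumElim a b) := by
    intro P
    refine ⟨fun h a b => h _, fun h m => ?_⟩
    have := h (Finsupp.sumFinsuppEquivProdFinsupp m).1 (Finsupp.sumFinsuppEquivProdFinsupp m).2
    rwa [← Finsupp.sumFinsuppEquivProdFinsupp.symm_apply_apply m]
  simp only [IsMonomialWitnessed]
  constructor
  · rintro ⟨c, h⟩
    obtain ⟨⟨a, b⟩, rfl⟩ := Finsupp.sumFinsuppEquivProdFinsupp.symm.surjective c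
    change ∀ m, monomial (m + Finsupp.sumElim a b) (1 : k) ∈ _ ↔ _ at h
    rw [hsplit] at h
    simp only [hadd, hI.monomial_mem_extL_add_extR_iff hJ] at h
    have h0 : ¬ (monomial a (1 : k) ∈ I ∨ monomial b (1 : k) ∈ J) := by
      simpa using (h 0 0).not
    push Not at h0
    refine ⟨⟨a, fun m => ?_⟩, ⟨b, fun m => ?_⟩⟩
    · simpa [h0.2] using h m 0
    · simpa [h0.1] using h 0 m
  · rintro ⟨⟨a, ha⟩, b, hb⟩
    refine ⟨Finsupp.sumElim a b, ?_⟩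
    rw [hsplit]
    intro m n
    rw [hadd, hI.monomial_mem_extL_add_extR_iff hJ, ha, hb]
    simp

end

/-- for monomial ideals `I ⊆ A`, `J ⊆ B`, `s ≥ 1` and `γ = (α, β)`,
`Δ_γ((I+J)^{(s)}) = ⋃_{j=1}^s Δ_α(I^{(j)}) ∗ Δ_β(J^{(s-j+1)})`: for every
`F ⊆ (σ ⊔ τ) \ G_γ`, `F ∈ Δ_γ((I+J)^{(s)})` iff there is `1 ≤ j ≤ s` with
`F ∩ σ ∈ Δ_α(I^{(j)})` and `F ∩ τ ∈ Δ_β(J^{(s-j+1)})`. -/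
theorem statement11 {σ τ : Type*} [Fintype σ] [Fintype τ]
    (I : Ideal (MvPolynomial σ k)) (J : Ideal (MvPolynomial τ k))
    (hI : IsMonomialIdeal k I) (hJ : IsMonomialIdeal k J)
    (s : ℕ) (hs : 1 ≤ s) (α : σ → ℤ) (β : τ → ℤ) :
    ∀ F : Set (σ ⊕ τ), F ⊆ (negSupp (Sum.elim α β))ᶜ →
      (F ∈ degCx k (symbPow (extL k I + extR k J) s) (Sum.elim α β) ↔
        ∃ j : ℕ, 1 ≤ j ∧ j ≤ s ∧ Sum.inl ⁻¹' F ∈ degCx k (symbPow I j) α ∧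
          Sum.inr ⁻¹' F ∈ degCx k (symbPow J (s - j + 1)) β) := by
  intro F hF
  have hFl : Sum.inl ⁻¹' F ⊆ (negSupp α)ᶜ := fun i hi => hF hi
  have hFr : Sum.inr ⁻¹' F ⊆ (negSupp β)ᶜ := fun i hi => hF hi
  rw [(hI.extL_add_extR hJ).mem_degCx_symbPow_iff]
  simp only [hI.mem_degCx_symbPow_iff, hJ.mem_degCx_symbPow_iff, hF, hFl, hFr, true_and]
  constructor
  · rintro ⟨V, hV, hVF, hlt⟩
    rw [← V.toLeft_disjSum_toRight] at hV hlt
    rw [hI.isMonomialWitnessed_extL_add_extR_iff hJ] at hV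
    simp only [Finset.sum_disjSum, Sum.elim_inl, Sum.elim_inr] at hlt
    exact ⟨∑ i ∈ V.toLeft, (α i).toNat + 1, by lia, by lia,
      ⟨V.toLeft, hV.1, fun i hi => hVF _ (Finset.mem_toLeft.1 hi), by lia⟩,
      ⟨V.toRight, hV.2, fun i hi => hVF _ (Finset.mem_toRight.1 hi), by lia⟩⟩
  · rintro ⟨j, hj1, hjs, ⟨T, hT, hTF, hTlt⟩, U, hU, hUF, hUlt⟩
    refine ⟨T.disjSum U, (hI.isMonomialWitnessed_extL_add_extR_iff hJ).2 ⟨hT, hU⟩, ?_, ?_⟩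
    · rintro (i | i) hi
      · exact hTF i (Finset.inl_mem_disjSum.1 hi)
      · exact hUF i (Finset.inr_mem_disjSum.1 hi)
    · simp only [Finset.sum_disjSum, Sum.elim_inl, Sum.elim_inr]
      lia
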